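/- arXiv:1611.09560 — 3 statements merged into one kernel-verified Lean document; each statement's English description precedes it below -/
import Mathlib

section
/- If A = ⟨A_i, p_{ii'}, I⟩ is a semilattice direct system of Boolean algebras (I a join-semilattice with least element i₀, each A_i a Boolean algebra, and each p_{ii'} : A_i → A_{i'} a Boolean algebra homomorphism for i ≤ i', with p_{ii} = id and p_{i'i''} ∘ p_{ii'} = p_{ii''}), then the Płonka sum P(A), whose universe is the disjoint union ⊔_{i∈I} A_i, with binary operations defined by mapping arguments a ∈ A_i, b ∈ A_j into A_{i∨j} via the transition homomorphisms and applying the operation of A_{i∨j}, with a' computed in the component containing a, and with constants 0 = 0^{A_{i₀}} and 1 = 1^{A_{i₀}}, is an involutive bisemilattice. -/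
universe u
/-- The axioms (I1)–(I8) of an involutive bisemilattice on a type `B` with
operations `·`, `+`, `'` and constants `0`, `1`. -/
structure IsInvolutiveBisemilattice {B : Type u} (mul add : B → B → B)
    (inv : B → B) (zero one : B) : Prop where
  add_idem : ∀ x, add x x = x
  add_comm : ∀ x y, add x y = add y x
  add_assoc : ∀ x y z, add x (add y z) = add (add x y) z
  inv_inv : ∀ x, inv (inv x) = x
  mul_def : ∀ x y, mul x y = inv (add (inv x) (inv y))
  mul_add_absorb : ∀ x y, mul x (add (inv x) y) = mul x y
  zero_add : ∀ x, add zero x = x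
  one_def : one = inv zero

/-- A semilattice direct system of Boolean algebras: a join-semilattice `I` with a
least element, Boolean algebras `A i`, and Boolean algebra homomorphisms
`p : A i → A i'` for `i ≤ i'`, compatible with identities and composition. -/
structure SemDirSysBA where
  I : Type u
  [slI : SemilatticeSup I]
  [botI : OrderBot I]
  A : I → Type u
  [ba : ∀ i, BooleanAlgebra (A i)]
  p : ∀ {i i' : I}, i ≤ i' → A i → A i'
  p_sup : ∀ {i i' : I} (h : i ≤ i') (a b : A i), p h (a ⊔ b) = p h a ⊔ p h b
  p_inf : ∀ {i i' : I} (h : i ≤ i') (a b : A i), p h (a ⊓ b) = p h a ⊓ p h b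
  p_bot : ∀ {i i' : I} (h : i ≤ i'), p h ⊥ = ⊥
  p_top : ∀ {i i' : I} (h : i ≤ i'), p h ⊤ = ⊤
  p_id : ∀ (i : I) (a : A i), p (le_refl i) a = a
  p_comp : ∀ {i i' i'' : I} (h : i ≤ i') (h' : i' ≤ i'') (a : A i),
    p h' (p h a) = p (le_trans h h') a

attribute [instance] SemDirSysBA.slI SemDirSysBA.botI SemDirSysBA.ba

/-- The universe of the Płonka sum: the disjoint union `⊔_{i ∈ I} A i`. -/
def PlonkaSum (𝔸 : SemDirSysBA.{u}) : Type u := Σ i : 𝔸.I, 𝔸.A i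

/-- The join `+` of the Płonka sum: arguments are transported into the component
at the join of their indices and joined there. -/
def padd (𝔸 : SemDirSysBA.{u}) : PlonkaSum 𝔸 → PlonkaSum 𝔸 → PlonkaSum 𝔸
  | ⟨i, a⟩, ⟨j, b⟩ => ⟨i ⊔ j, 𝔸.p le_sup_left a ⊔ 𝔸.p le_sup_right b⟩

/-- The meet `·` of the Płonka sum. -/
def pmul (𝔸 : SemDirSysBA.{u}) : PlonkaSum 𝔸 → PlonkaSum 𝔸 → PlonkaSum 𝔸
  | ⟨i, a⟩, ⟨j, b⟩ => ⟨i ⊔ j, 𝔸.p le_sup_left a ⊓ 𝔸.p le_sup_right b⟩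

/-- The involution `'` of the Płonka sum, computed componentwise. -/
def pinv (𝔸 : SemDirSysBA.{u}) : PlonkaSum 𝔸 → PlonkaSum 𝔸
  | ⟨i, a⟩ => ⟨i, aᶜ⟩

/-- The constant `0` of the Płonka sum: the bottom of the component at the least index. -/
def pzero (𝔸 : SemDirSysBA.{u}) : PlonkaSum 𝔸 := ⟨⊥, (⊥ : 𝔸.A ⊥)⟩

/-- The constant `1` of the Płonka sum: the top of the component at the least index. -/
def pone (𝔸 : SemDirSysBA.{u}) : PlonkaSum 𝔸 := ⟨⊥, (⊤ : 𝔸.A ⊥)⟩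

/-- A homomorphism of involutive bisemilattices between two Płonka sums of
semilattice direct systems of Boolean algebras: a map preserving `·`, `+`, `'`,
`0` and `1`. -/
structure IsPlonkaHom (𝔸 𝔹 : SemDirSysBA.{u}) (h : PlonkaSum 𝔸 → PlonkaSum 𝔹) : Prop where
  map_add : ∀ x y, h (padd 𝔸 x y) = padd 𝔹 (h x) (h y)
  map_mul : ∀ x y, h (pmul 𝔸 x y) = pmul 𝔹 (h x) (h y)
  map_inv : ∀ x, h (pinv 𝔸 x) = pinv 𝔹 (h x)
  map_zero : h (pzero 𝔸) = pzero 𝔹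
  map_one : h (pone 𝔸) = pone 𝔹
theorem plonka_ext (𝔸 : SemDirSysBA.{u}) {i j : 𝔸.I} (h : i = j) (a : 𝔸.A i) (b : 𝔸.A j)
    (hab : 𝔸.p h.le a = b) : (⟨i, a⟩ : PlonkaSum 𝔸) = ⟨j, b⟩ := by
  subst h
  rw [𝔸.p_id] at hab
  rw [hab]

theorem plonka_compl (𝔸 : SemDirSysBA.{u}) {i j : 𝔸.I} (h : i ≤ j) (a : 𝔸.A i) :
    𝔸.p h aᶜ = (𝔸.p h a)ᶜ := by
  symm
  apply IsCompl.compl_eq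
  apply IsCompl.of_eq
  · rw [← 𝔸.p_inf, inf_compl_eq_bot, 𝔸.p_bot]
  · rw [← 𝔸.p_sup, sup_compl_eq_top, 𝔸.p_top]

/-- **Statement 5.** The Płonka sum of a semilattice direct system of Boolean
algebras — with `+` and `·` computed in the component at the join of the indices
via the transition homomorphisms, the involution computed componentwise, and the
constants taken in the component at the least index — is an involutive
bisemilattice. -/
theorem plonkaSum_isInvolutiveBisemilattice (𝔸 : SemDirSysBA.{u}) :
    IsInvolutiveBisemilattice (pmul 𝔸) (padd 𝔸) (pinv 𝔸) (pzero 𝔸) (pone 𝔸) := by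
  constructor
  · rintro ⟨i, a⟩
    refine plonka_ext 𝔸 (sup_idem i) _ _ ?_
    simp only [𝔸.p_sup, 𝔸.p_comp, 𝔸.p_id, sup_idem]
  · rintro ⟨i, a⟩ ⟨j, b⟩
    refine plonka_ext 𝔸 (sup_comm i j) _ _ ?_
    simp only [𝔸.p_sup, 𝔸.p_comp]
    exact sup_comm _ _
  · rintro ⟨i, a⟩ ⟨j, b⟩ ⟨k, c⟩
    refine plonka_ext 𝔸 (sup_assoc i j k).symm _ _ ?_
    simp only [𝔸.p_sup, 𝔸.p_comp]
    exact (sup_assoc _ _ _).symm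
  · rintro ⟨i, a⟩
    refine plonka_ext 𝔸 rfl _ _ ?_
    simp only [𝔸.p_id, compl_compl]
  · rintro ⟨i, a⟩ ⟨j, b⟩
    refine plonka_ext 𝔸 rfl _ _ ?_
    simp only [𝔸.p_id, plonka_compl, compl_sup, compl_compl]
  · rintro ⟨i, a⟩ ⟨j, b⟩
    refine plonka_ext 𝔸 (by simp : i ⊔ (i ⊔ j) = i ⊔ j) _ _ ?_
    simp only [𝔸.p_sup, 𝔸.p_inf, 𝔸.p_comp, plonka_compl]
    rw [inf_sup_left, inf_compl_eq_bot, bot_sup_eq]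
  · rintro ⟨i, a⟩
    refine plonka_ext 𝔸 (bot_sup_eq i) _ _ ?_
    simp only [𝔸.p_sup, 𝔸.p_comp, 𝔸.p_bot, 𝔸.p_id, bot_sup_eq]
  · refine plonka_ext 𝔸 rfl _ _ ?_
    simp only [𝔸.p_id, compl_bot]
end

section
/- Let A = ⟨A_i, p_{ii'}, I⟩ and B = ⟨B_j, q_{jj'}, J⟩ be semilattice direct systems of Boolean algebras, let P(A) and P(B) be their Płonka sums, and let h : P(A) → P(B) be a homomorphism of involutive bisemilattices. Then for every i ∈ I there exists j ∈ J such that h(A_i) ⊆ B_j, and the restriction of h to A_i is a Boolean algebra homomorphism from A_i into B_j (in particular h maps 0^{A_i} to 0^{B_j} and 1^{A_i} to 1^{B_j}). -/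
universe u
theorem padd_same (𝔸 : SemDirSysBA.{u}) (i : 𝔸.I) (a b : 𝔸.A i) :
    padd 𝔸 ⟨i, a⟩ ⟨i, b⟩ = ⟨i, a ⊔ b⟩ := by
  have key : ∀ (k : 𝔸.I) (h1 h2 : i ≤ k), k = i →
      (⟨k, 𝔸.p h1 a ⊔ 𝔸.p h2 b⟩ : Σ i : 𝔸.I, 𝔸.A i) = ⟨i, a ⊔ b⟩ := by
    rintro k h1 h2 rfl
    rw [𝔸.p_id, 𝔸.p_id]
  exact key (i ⊔ i) le_sup_left le_sup_right (sup_idem i)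

theorem pmul_same (𝔸 : SemDirSysBA.{u}) (i : 𝔸.I) (a b : 𝔸.A i) :
    pmul 𝔸 ⟨i, a⟩ ⟨i, b⟩ = ⟨i, a ⊓ b⟩ := by
  have key : ∀ (k : 𝔸.I) (h1 h2 : i ≤ k), k = i →
      (⟨k, 𝔸.p h1 a ⊓ 𝔸.p h2 b⟩ : Σ i : 𝔸.I, 𝔸.A i) = ⟨i, a ⊓ b⟩ := by
    rintro k h1 h2 rfl
    rw [𝔸.p_id, 𝔸.p_id]
  exact key (i ⊔ i) le_sup_left le_sup_right (sup_idem i)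

theorem sigma_snd_inj (𝔸 : SemDirSysBA.{u}) (i : 𝔸.I) (a b : 𝔸.A i)
    (h : (⟨i, a⟩ : PlonkaSum 𝔸) = ⟨i, b⟩) : a = b :=
  eq_of_heq (Sigma.mk.inj h).2

/-- **Statement 6.** If `h` is a homomorphism of involutive bisemilattices between
the Płonka sums of two semilattice direct systems of Boolean algebras, then every
component `A i` is mapped by `h` into a single component `B j`, and the restriction
of `h` to `A i` is a Boolean algebra homomorphism into `B j` (in particular it
sends `⊥` to `⊥` and `⊤` to `⊤`). -/
theorem plonkaHom_maps_components_into_components (𝔸 𝔹 : SemDirSysBA.{u})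
    (h : PlonkaSum 𝔸 → PlonkaSum 𝔹) (hh : IsPlonkaHom 𝔸 𝔹 h) (i : 𝔸.I) :
    ∃ (j : 𝔹.I) (g : 𝔸.A i → 𝔹.A j),
      (∀ a : 𝔸.A i, h ⟨i, a⟩ = ⟨j, g a⟩) ∧
      (∀ a b : 𝔸.A i, g (a ⊔ b) = g a ⊔ g b) ∧
      (∀ a b : 𝔸.A i, g (a ⊓ b) = g a ⊓ g b) ∧
      (∀ a : 𝔸.A i, g aᶜ = (g a)ᶜ) ∧
      g ⊥ = ⊥ ∧ g ⊤ = ⊤ := by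
  have hbot : ∀ a : 𝔸.A i, ∀ (j : 𝔹.I) (b : 𝔹.A j), h ⟨i, a⟩ = ⟨j, b⟩ →
      h ⟨i, ⊥⟩ = ⟨j, ⊥⟩ := by
    intro a j b hab
    have h1 := hh.map_mul ⟨i, a⟩ (pinv 𝔸 ⟨i, a⟩)
    rw [hh.map_inv ⟨i, a⟩, hab] at h1
    change h (pmul 𝔸 ⟨i, a⟩ ⟨i, aᶜ⟩) = pmul 𝔹 ⟨j, b⟩ ⟨j, bᶜ⟩ at h1
    rwa [pmul_same, pmul_same, inf_compl_self, inf_compl_self] at h1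
  obtain ⟨j, hj⟩ : ∃ j : 𝔹.I, h ⟨i, ⊥⟩ = ⟨j, ⊥⟩ := ⟨_, hbot ⊥ _ (h ⟨i, ⊥⟩).2 rfl⟩
  have hex : ∀ a : 𝔸.A i, ∃ b : 𝔹.A j, h ⟨i, a⟩ = ⟨j, b⟩ := by
    intro a
    obtain ⟨j', b, hb⟩ : ∃ (j' : 𝔹.I) (b : 𝔹.A j'), h ⟨i, a⟩ = ⟨j', b⟩ :=
      ⟨_, (h ⟨i, a⟩).2, rfl⟩
    have h2 := (hbot a j' b hb).symm.trans hj
    obtain rfl : j' = j := (Sigma.mk.inj h2).1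
    exact ⟨b, hb⟩
  choose g hg using hex
  have hc : ∀ a : 𝔸.A i, g aᶜ = (g a)ᶜ := by
    intro a
    have h1 := hh.map_inv ⟨i, a⟩
    rw [hg] at h1
    change h ⟨i, aᶜ⟩ = ⟨j, (g a)ᶜ⟩ at h1
    rw [hg] at h1
    exact sigma_snd_inj _ _ _ _ h1
  have hb : g ⊥ = ⊥ := sigma_snd_inj _ _ _ _ ((hg ⊥).symm.trans hj)
  refine ⟨j, g, hg, ?_, ?_, hc, hb, ?_⟩
  · intro a b
    have h1 := hh.map_add ⟨i, a⟩ ⟨i, b⟩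
    rw [padd_same, hg, hg, hg, padd_same] at h1
    exact sigma_snd_inj _ _ _ _ h1
  · intro a b
    have h1 := hh.map_mul ⟨i, a⟩ ⟨i, b⟩
    rw [pmul_same, hg, hg, hg, pmul_same] at h1
    exact sigma_snd_inj _ _ _ _ h1
  · rw [← compl_bot, hc, hb, compl_bot]
end

section
/- Let L and M be bisemilattices that are the Płonka sums of semilattice direct systems of distributive lattices ⟨L_i, φ_{ii'}, I⟩ and ⟨M_j, φ_{jj'}, J⟩ respectively, and let h : L → M be a homomorphism of bisemilattices. Then for every i ∈ I there exists j ∈ J such that h(L_i) ⊆ M_j; moreover the resulting index map φ : I → J, determined by h(L_i) ⊆ M_{φ(i)}, is a homomorphism of join-semilattices. -/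
universe u
/-- A semilattice direct system of distributive lattices: a join-semilattice `I`
with a least element, nonempty distributive lattices `L i`, and lattice
homomorphisms `p : L i → L i'` for `i ≤ i'`, compatible with identities and
composition. -/
structure SemDirSysDL where
  I : Type u
  [slI : SemilatticeSup I]
  [botI : OrderBot I]
  L : I → Type u
  [dl : ∀ i, DistribLattice (L i)]
  [ne : ∀ i, Nonempty (L i)]
  p : ∀ {i i' : I}, i ≤ i' → L i → L i'
  p_sup : ∀ {i i' : I} (h : i ≤ i') (a b : L i), p h (a ⊔ b) = p h a ⊔ p h b
  p_inf : ∀ {i i' : I} (h : i ≤ i') (a b : L i), p h (a ⊓ b) = p h a ⊓ p h b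
  p_id : ∀ (i : I) (a : L i), p (le_refl i) a = a
  p_comp : ∀ {i i' i'' : I} (h : i ≤ i') (h' : i' ≤ i'') (a : L i),
    p h' (p h a) = p (le_trans h h') a

attribute [instance] SemDirSysDL.slI SemDirSysDL.botI SemDirSysDL.dl SemDirSysDL.ne

/-- The universe of the Płonka sum of a semilattice direct system of distributive
lattices: the disjoint union `⊔_{i ∈ I} L i`. -/
def PlonkaSumDL (𝕃 : SemDirSysDL.{u}) : Type u := Σ i : 𝕃.I, 𝕃.L i

/-- The join `+` of the Płonka sum: arguments are transported into the component
at the join of their indices and joined there. -/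
def paddDL (𝕃 : SemDirSysDL.{u}) : PlonkaSumDL 𝕃 → PlonkaSumDL 𝕃 → PlonkaSumDL 𝕃
  | ⟨i, a⟩, ⟨j, b⟩ => ⟨i ⊔ j, 𝕃.p le_sup_left a ⊔ 𝕃.p le_sup_right b⟩

/-- The meet `·` of the Płonka sum. -/
def pmulDL (𝕃 : SemDirSysDL.{u}) : PlonkaSumDL 𝕃 → PlonkaSumDL 𝕃 → PlonkaSumDL 𝕃
  | ⟨i, a⟩, ⟨j, b⟩ => ⟨i ⊔ j, 𝕃.p le_sup_left a ⊓ 𝕃.p le_sup_right b⟩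
theorem plonka_aux_pull (𝕃 : SemDirSysDL.{u}) {i k : 𝕃.I} (e : i = k) (h : i ≤ k) (a : 𝕃.L i) :
    (⟨k, 𝕃.p h a⟩ : PlonkaSumDL 𝕃) = ⟨i, a⟩ := by
  subst e
  rw [𝕃.p_id]

theorem plonka_aux_add (𝕃 : SemDirSysDL.{u}) (i : 𝕃.I) (a b : 𝕃.L i) :
    paddDL 𝕃 ⟨i, a⟩ ⟨i, b⟩ = ⟨i, a ⊔ b⟩ := by
  have := plonka_aux_pull 𝕃 (sup_idem i).symm le_sup_left (a ⊔ b)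
  rw [𝕃.p_sup] at this
  exact this

theorem plonka_aux_mul (𝕃 : SemDirSysDL.{u}) (i : 𝕃.I) (a b : 𝕃.L i) :
    pmulDL 𝕃 ⟨i, a⟩ ⟨i, b⟩ = ⟨i, a ⊓ b⟩ := by
  have := plonka_aux_pull 𝕃 (sup_idem i).symm le_sup_left (a ⊓ b)
  rw [𝕃.p_inf] at this
  exact this

theorem plonka_aux_fst_add (𝕃 : SemDirSysDL.{u}) (x y : PlonkaSumDL 𝕃) :
    (paddDL 𝕃 x y).1 = x.1 ⊔ y.1 := rfl

theorem plonka_aux_fst_mul (𝕃 : SemDirSysDL.{u}) (x y : PlonkaSumDL 𝕃) :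
    (pmulDL 𝕃 x y).1 = x.1 ⊔ y.1 := rfl

/-- **Statement 18.** Let `L` and `M` be the bisemilattices arising as Płonka sums
of semilattice direct systems of distributive lattices, and let `h : L → M` be a
homomorphism of bisemilattices (preserving `+` and `·`). Then every component
`L i` is mapped by `h` into a single component `M j`; moreover the resulting index
map `φ : I → J`, determined by `h (L i) ⊆ M (φ i)`, is a homomorphism of
join-semilattices. -/
theorem bisemHom_components_and_index_map (𝕃 𝕄 : SemDirSysDL.{u})
    (h : PlonkaSumDL 𝕃 → PlonkaSumDL 𝕄)
    (hadd : ∀ x y, h (paddDL 𝕃 x y) = paddDL 𝕄 (h x) (h y))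
    (hmul : ∀ x y, h (pmulDL 𝕃 x y) = pmulDL 𝕄 (h x) (h y)) :
    (∀ i : 𝕃.I, ∃ j : 𝕄.I, ∀ a : 𝕃.L i, (h ⟨i, a⟩).1 = j) ∧
    (∀ φ : 𝕃.I → 𝕄.I, (∀ (i : 𝕃.I) (a : 𝕃.L i), (h ⟨i, a⟩).1 = φ i) →
      ∀ i i' : 𝕃.I, φ (i ⊔ i') = φ i ⊔ φ i') := by
  have key : ∀ (i : 𝕃.I) (a b : 𝕃.L i), (h ⟨i, b⟩).1 ≤ (h ⟨i, a⟩).1 := by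
    intro i a b
    have h3 : ∀ c d : 𝕃.L i, (h ⟨i, c ⊓ d⟩).1 = (h ⟨i, c⟩).1 ⊔ (h ⟨i, d⟩).1 := fun c d =>
      (congrArg (fun x => (h x).1) (plonka_aux_mul 𝕃 i c d)).symm.trans
        (congrArg Sigma.fst (hmul ⟨i, c⟩ ⟨i, d⟩))
    have h4 : ∀ c d : 𝕃.L i, (h ⟨i, c ⊔ d⟩).1 = (h ⟨i, c⟩).1 ⊔ (h ⟨i, d⟩).1 := fun c d =>
      (congrArg (fun x => (h x).1) (plonka_aux_add 𝕃 i c d)).symm.trans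
        (congrArg Sigma.fst (hadd ⟨i, c⟩ ⟨i, d⟩))
    have h2 := h4 a (a ⊓ b)
    rw [h3, sup_inf_self] at h2
    exact (le_sup_right.trans le_sup_right).trans h2.ge
  refine ⟨fun i => ?_, fun φ hφ i i' => ?_⟩
  · obtain ⟨a⟩ := 𝕃.ne i
    exact ⟨(h ⟨i, a⟩).1, fun b => le_antisymm (key i a b) (key i b a)⟩
  · obtain ⟨a⟩ := 𝕃.ne i
    obtain ⟨b⟩ := 𝕃.ne i'
    rw [← hφ i a, ← hφ i' b]
    exact (hφ (i ⊔ i') _).symm.trans (congrArg Sigma.fst (hadd ⟨i, a⟩ ⟨i', b⟩))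
end
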